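/- arXiv:2102.06543 — 2 statements merged into one kernel-verified Lean document; each statement's English description precedes it below -/
import Mathlib

section
/- Let L=(T,V,E) be a link stream, (i,u) ∈ T×V, w ∈ V, and let t < t' in T with i ≤ t be such that the graph G_s is one and the same graph G⁺ for every s ∈ ]t,t'[; write d⁺(x,y) for the graph distance in G⁺. Then: (a) if y ∈ V is such that the pair yw is an edge of G_{t'}, d((i,u),(t',y)) + 1 = d((i,u),(t',w)), and P is a shortest path from (i,u) to (t',y), then the path obtained from P by appending the time t' and the node w is a shortest path from (i,u) to (t',w); (b) if x ∈ V satisfies d((i,u),(t,x)) + d⁺(x,w) = d((i,u),(t',w)), P₁ is a shortest path from (i,u) to (t,x), and P₂ is a path from (t,x) to (t',w) with all times in ]t,t'[ of minimal length among such paths, then the concatenation of P₁ and P₂ is a shortest path from (i,u) to (t',w). -/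
/-!
Common definitions: link streams, paths, distances, latency pairs, etc.
-/

/-- A link stream `L = (T,V,E)` with `T = [tmin, tmax]` an interval of `ℝ`,
nodes `V`, and links `E ⊆ T × (V ⊗ V)` (unordered pairs of distinct nodes). -/
structure LinkStream (V : Type*) where
  tmin : ℝ
  tmax : ℝ
  hminmax : tmin ≤ tmax
  E : Set (ℝ × Sym2 V)
  hT : ∀ p ∈ E, p.1 ∈ Set.Icc tmin tmax
  hND : ∀ p ∈ E, ¬ p.2.IsDiag

/-- starting time of a path of length `k ≥ 1` given by its times (junk value for `k = 0`). -/
noncomputable def startT {k : ℕ} (times : Fin k → ℝ) : ℝ :=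
  if h : 0 < k then times ⟨0, h⟩ else 0

/-- arrival time of a path of length `k ≥ 1` given by its times (junk value for `k = 0`). -/
noncomputable def arrT {k : ℕ} (times : Fin k → ℝ) : ℝ :=
  if _ : 0 < k then times ⟨k - 1, by omega⟩ else 0

/-- The path `v₀,t₁,v₁,…,t_k,v_k` involves `(t,v)`. -/
def Involves {V : Type*} {k : ℕ} (nodes : Fin (k + 1) → V) (times : Fin k → ℝ)
    (t : ℝ) (v : V) : Prop :=
  (∃ i : ℕ, ∃ _ : 1 ≤ i, ∃ _ : i + 1 ≤ k,
     v = nodes ⟨i, by omega⟩ ∧ times ⟨i - 1, by omega⟩ ≤ t ∧ t ≤ times ⟨i, by omega⟩) ∨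
  (∃ h : 1 ≤ k, v = nodes 0 ∧ t = times ⟨0, h⟩) ∨
  (∃ h : 1 ≤ k, v = nodes (Fin.last k) ∧ t = times ⟨k - 1, by omega⟩)

/-- `A` is a finite union of pairwise disjoint closed intervals (possibly singletons). -/
def FiniteClosedUnion (A : Set ℝ) : Prop :=
  ∃ S : Finset (ℝ × ℝ), (∀ p ∈ S, p.1 ≤ p.2) ∧
    (A = ⋃ p ∈ S, Set.Icc p.1 p.2) ∧
    (S : Set (ℝ × ℝ)).Pairwise fun p q => Disjoint (Set.Icc p.1 p.2) (Set.Icc q.1 q.2)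

namespace LinkStream

variable {V : Type*}

/-- `T_uv`: the set of time instants at which `u` and `v` are linked. -/
def Tuv (L : LinkStream V) (u v : V) : Set ℝ := {t | (t, s(u, v)) ∈ L.E}

/-- `G_t`: the graph at time `t`. -/
def Gt (L : LinkStream V) (t : ℝ) : SimpleGraph V where
  Adj u v := (t, s(u, v)) ∈ L.E
  symm := ⟨fun u v h => by rwa [Sym2.eq_swap] at h⟩
  loopless := ⟨fun u h => L.hND _ h (by simp)⟩

/-- `(nodes, times)` is a path of length `k` from `(x,u)` to `(y,w)` in `L`. -/
def IsPathOn (L : LinkStream V) (x : ℝ) (u : V) (y : ℝ) (w : V) (k : ℕ)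
    (nodes : Fin (k + 1) → V) (times : Fin k → ℝ) : Prop :=
  nodes 0 = u ∧ nodes (Fin.last k) = w ∧ x ≤ y ∧
  (∀ m, x ≤ times m ∧ times m ≤ y) ∧
  (∀ m m' : Fin k, m ≤ m' → times m ≤ times m') ∧
  (∀ m : Fin k, (times m, s(nodes m.castSucc, nodes m.succ)) ∈ L.E)

/-- `(y,w)` is reachable from `(x,u)`, written `(x,u) ⟶ (y,w)`. -/
def Reach (L : LinkStream V) (x : ℝ) (u : V) (y : ℝ) (w : V) : Prop :=
  ∃ k nodes times, L.IsPathOn x u y w k nodes times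

/-- the distance `d((x,u),(y,w))`: minimal length of a path (junk value `0` if unreachable). -/
noncomputable def dist (L : LinkStream V) (x : ℝ) (u : V) (y : ℝ) (w : V) : ℕ :=
  sInf {k | ∃ nodes times, L.IsPathOn x u y w k nodes times}

/-- `(nodes, times)` is a shortest path from `(x,u)` to `(y,w)`. -/
def IsShortest (L : LinkStream V) (x : ℝ) (u : V) (y : ℝ) (w : V) (k : ℕ)
    (nodes : Fin (k + 1) → V) (times : Fin k → ℝ) : Prop :=
  L.IsPathOn x u y w k nodes times ∧
  ∀ k' nodes' times', L.IsPathOn x u y w k' nodes' times' → k ≤ k'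

/-- `(s,a)` is a latency pair from `u` to `w`. -/
def IsLatencyPair (L : LinkStream V) (u w : V) (s a : ℝ) : Prop :=
  s ∈ Set.Icc L.tmin L.tmax ∧ a ∈ Set.Icc L.tmin L.tmax ∧ s ≤ a ∧
  (∃ k nodes times, 1 ≤ k ∧ L.IsPathOn s u a w k nodes times) ∧
  (∀ k nodes (times : Fin k → ℝ), 1 ≤ k → L.IsPathOn s u a w k nodes times →
     startT times = s ∧ arrT times = a)

/-- `(nodes, times)` is a fastest path from `(i,u)` to `(j,w)`:
a path of minimal duration among all (length ≥ 1) paths from `(i,u)` to `(j,w)`. -/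
def IsFastest (L : LinkStream V) (i : ℝ) (u : V) (j : ℝ) (w : V) (k : ℕ)
    (nodes : Fin (k + 1) → V) (times : Fin k → ℝ) : Prop :=
  1 ≤ k ∧ L.IsPathOn i u j w k nodes times ∧
  ∀ k' (nodes' : Fin (k' + 1) → V) (times' : Fin k' → ℝ), 1 ≤ k' →
    L.IsPathOn i u j w k' nodes' times' →
    arrT times - startT times ≤ arrT times' - startT times'

/-- `(nodes, times)` is a shortest fastest path from `(i,u)` to `(j,w)`. -/
def IsSFP (L : LinkStream V) (i : ℝ) (u : V) (j : ℝ) (w : V) (k : ℕ)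
    (nodes : Fin (k + 1) → V) (times : Fin k → ℝ) : Prop :=
  L.IsFastest i u j w k nodes times ∧
  ∀ k' nodes' times', L.IsFastest i u j w k' nodes' times' → k ≤ k'

/-- a path from `(t,x)` to `(t',w)` whose times all lie in `]t,t'[`. -/
def IsPathIoo (L : LinkStream V) (t : ℝ) (x : V) (t' : ℝ) (w : V) (k : ℕ)
    (nodes : Fin (k + 1) → V) (times : Fin k → ℝ) : Prop :=
  L.IsPathOn t x t' w k nodes times ∧ ∀ m, times m ∈ Set.Ioo t t'

/-- a path from `(t,x)` to `(t',w)` with all times in `]t,t'[`, of minimal length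
among all such paths. -/
def IsMinPathIoo (L : LinkStream V) (t : ℝ) (x : V) (t' : ℝ) (w : V) (k : ℕ)
    (nodes : Fin (k + 1) → V) (times : Fin k → ℝ) : Prop :=
  L.IsPathIoo t x t' w k nodes times ∧
  ∀ k' nodes' times', L.IsPathIoo t x t' w k' nodes' times' → k ≤ k'

/-- `t` is an event time: an endpoint of a maximal interval of some `T_uv`. -/
def IsEventTime (L : LinkStream V) (t : ℝ) : Prop :=
  ∃ u v b e, b ≤ e ∧ Set.Icc b e ⊆ L.Tuv u v ∧
    (∀ b' e', b' ≤ b → e ≤ e' → Set.Icc b' e' ⊆ L.Tuv u v → b' = b ∧ e' = e) ∧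
    (t = b ∨ t = e)

end LinkStream

namespace LinkStream

theorem IsShortest.dist_eq {V : Type*} {L : LinkStream V} {x y : ℝ} {u w : V} {k : ℕ}
    {nodes : Fin (k + 1) → V} {times : Fin k → ℝ}
    (h : L.IsShortest x u y w k nodes times) : L.dist x u y w = k :=
  le_antisymm (Nat.sInf_le ⟨nodes, times, h.1⟩)
    (le_csInf ⟨k, nodes, times, h.1⟩ fun _ ⟨_, _, hp⟩ => h.2 _ _ _ hp)

theorem IsPathOn.isShortest_of_le_dist {V : Type*} {L : LinkStream V} {x y : ℝ} {u w : V} {k : ℕ}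
    {nodes : Fin (k + 1) → V} {times : Fin k → ℝ} (h : L.IsPathOn x u y w k nodes times)
    (hk : k ≤ L.dist x u y w) : L.IsShortest x u y w k nodes times :=
  ⟨h, fun _ nodes' times' hp => hk.trans (Nat.sInf_le ⟨nodes', times', hp⟩)⟩

/-- Appending a link at the arrival bound to a path gives a path. -/
theorem IsPathOn.snoc {V : Type*} {L : LinkStream V} {x y : ℝ} {u v w : V} {k : ℕ}
    {nodes : Fin (k + 1) → V} {times : Fin k → ℝ} (h : L.IsPathOn x u y v k nodes times)
    (hvw : (L.Gt y).Adj v w) :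
    L.IsPathOn x u y w (k + 1) (Fin.snoc nodes w) (Fin.snoc times y) := by
  obtain ⟨h0, hl, hxy, hb, hm, hE⟩ := h
  refine ⟨?_, by simp, hxy, ?_, ?_, ?_⟩
  · rw [← Fin.castSucc_zero, Fin.snoc_castSucc, h0]
  · intro m
    induction m using Fin.lastCases with
    | last => simpa using hxy
    | cast m => simpa using hb m
  · intro m m' hmm
    induction m' using Fin.lastCases with
    | last =>
      induction m using Fin.lastCases with
      | last => simp
      | cast m => simpa using (hb m).2
    | cast m' =>
      induction m using Fin.lastCases with
      | last => exact absurd hmm (not_le.mpr (Fin.castSucc_lt_last m'))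
      | cast m => simpa using hm m m' (by simpa using hmm)
  · intro m
    induction m using Fin.lastCases with
    | last =>
      rw [Fin.succ_last, Fin.snoc_last, Fin.snoc_last, Fin.snoc_castSucc, hl]
      exact hvw
    | cast m =>
      rw [Fin.succ_castSucc, Fin.snoc_castSucc, Fin.snoc_castSucc, Fin.snoc_castSucc]
      exact hE m

/-- A sequence of nodes and times that follows a path to `(y, v)`, and then a path from `(y, v)`,
is a path. -/
theorem IsPathOn.concat {V : Type*} {L : LinkStream V} {x y z : ℝ} {u v w : V} {k₁ k₂ : ℕ}
    {nodes₁ : Fin (k₁ + 1) → V} {times₁ : Fin k₁ → ℝ}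
    {nodes₂ : Fin (k₂ + 1) → V} {times₂ : Fin k₂ → ℝ}
    (h₁ : L.IsPathOn x u y v k₁ nodes₁ times₁) (h₂ : L.IsPathOn y v z w k₂ nodes₂ times₂)
    {nodes : Fin (k₁ + k₂ + 1) → V} {times : Fin (k₁ + k₂) → ℝ}
    (hn₁ : ∀ m a, m.val = a.val → nodes m = nodes₁ a)
    (hn₂ : ∀ m a, m.val = k₁ + a.val → nodes m = nodes₂ a)
    (ht₁ : ∀ a, times (Fin.castAdd k₂ a) = times₁ a)
    (ht₂ : ∀ a, times (Fin.natAdd k₁ a) = times₂ a) :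
    L.IsPathOn x u z w (k₁ + k₂) nodes times := by
  obtain ⟨h0, -, hxy, hb, hm, hE⟩ := h₁
  obtain ⟨-, hl', hyz, hb', hm', hF⟩ := h₂
  refine ⟨?_, ?_, hxy.trans hyz, ?_, ?_, ?_⟩
  · rw [hn₁ 0 0 rfl, h0]
  · rw [hn₂ (Fin.last _) (Fin.last _) rfl, hl']
  · intro m
    induction m using Fin.addCases with
    | left a =>
      rw [ht₁]
      exact ⟨(hb a).1, (hb a).2.trans hyz⟩
    | right a =>
      rw [ht₂]
      exact ⟨hxy.trans (hb' a).1, (hb' a).2⟩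
  · intro m m' hmm
    induction m using Fin.addCases with
    | left a =>
      induction m' using Fin.addCases with
      | left a' =>
        rw [ht₁, ht₁]
        exact hm a a' hmm
      | right a' =>
        rw [ht₁, ht₂]
        exact (hb a).2.trans (hb' a').1
    | right a =>
      induction m' using Fin.addCases with
      | left a' =>
        simp only [Fin.le_def, Fin.val_natAdd, Fin.val_castAdd] at hmm
        omega
      | right a' =>
        rw [ht₂, ht₂]
        exact hm' a a' (by simpa using hmm)
  · intro m
    induction m using Fin.addCases with
    | left a =>
      rw [ht₁, hn₁ _ a.castSucc rfl, hn₁ _ a.succ rfl]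
      exact hE a
    | right a =>
      rw [ht₂, hn₂ _ a.castSucc rfl, hn₂ _ a.succ rfl]
      exact hF a

/-- A path whose times all see the same graph connects its end nodes in that graph. -/
theorem IsPathIoo.reachable {V : Type*} {L : LinkStream V} {t t' : ℝ} {x w : V} {k : ℕ}
    {nodes : Fin (k + 1) → V} {times : Fin k → ℝ} {G : SimpleGraph V}
    (h : L.IsPathIoo t x t' w k nodes times) (hG : ∀ s ∈ Set.Ioo t t', L.Gt s = G) :
    G.Reachable x w := by
  obtain ⟨⟨h0, hl, -, -, -, hE⟩, hI⟩ := h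
  have key : ∀ m, G.Reachable (nodes 0) (nodes m) := by
    intro m
    induction m using Fin.induction with
    | zero => exact SimpleGraph.Reachable.refl _
    | succ m ih =>
      refine ih.trans (SimpleGraph.Adj.reachable ?_)
      rw [← hG _ (hI m)]
      exact hE m
  simpa only [h0, hl] using key (Fin.last k)

/-- A walk in the graph at time `s` yields a path all of whose times are `s`. -/
theorem isPathIoo_of_walk {V : Type*} {L : LinkStream V} {t t' s : ℝ} (hs : s ∈ Set.Ioo t t')
    {x w : V} (p : (L.Gt s).Walk x w) :
    L.IsPathIoo t x t' w p.length (fun m => p.getVert m) (fun _ => s) :=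
  ⟨⟨p.getVert_zero, p.getVert_length, (hs.1.trans hs.2).le, fun _ => ⟨hs.1.le, hs.2.le⟩,
    fun _ _ _ => le_rfl, fun m => p.adj_getVert_succ m.isLt⟩, fun _ => hs⟩

/-- A length-minimal path inside an open interval where the graph is constantly `G` is at most
as long as the distance in `G`. -/
theorem IsMinPathIoo.le_dist {V : Type*} {L : LinkStream V} {t t' : ℝ} {x w : V} {k : ℕ}
    {nodes : Fin (k + 1) → V} {times : Fin k → ℝ} {G : SimpleGraph V}
    (h : L.IsMinPathIoo t x t' w k nodes times) (htt : t < t')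
    (hG : ∀ s ∈ Set.Ioo t t', L.Gt s = G) : k ≤ G.dist x w := by
  obtain ⟨s, hs⟩ := exists_between htt
  have hr := h.1.reachable hG
  obtain rfl := hG s hs
  obtain ⟨p, hp⟩ := hr.exists_walk_length_eq_dist
  rw [← hp]
  exact h.2 _ _ _ (isPathIoo_of_walk hs p)

end LinkStream

/-- composition of shortest paths. (a) Appending `(t',w)` to a shortest path
to `(t',y)` with `yw` an edge of `G_{t'}` and `d((i,u),(t',y)) + 1 = d((i,u),(t',w))`
gives a shortest path to `(t',w)`; (b) concatenating a shortest path to `(t,x)` with a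
minimal-length path from `(t,x)` to `(t',w)` with all times in `]t,t'[`, when
`d((i,u),(t,x)) + d⁺(x,w) = d((i,u),(t',w))`, gives a shortest path to `(t',w)`. -/
theorem shortest_path_composition {V : Type*} (L : LinkStream V) (i : ℝ) (u w : V)
    (t t' : ℝ) (hit : i ≤ t) (htt : t < t')
    (Gp : SimpleGraph V) (hG : ∀ s ∈ Set.Ioo t t', L.Gt s = Gp) :
    (∀ y : V, (L.Gt t').Adj y w → L.dist i u t' y + 1 = L.dist i u t' w →
      ∀ k nodes times, L.IsShortest i u t' y k nodes times →
        L.IsShortest i u t' w (k + 1) (Fin.snoc nodes w) (Fin.snoc times t')) ∧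
    (∀ x : V, L.dist i u t x + Gp.dist x w = L.dist i u t' w →
      ∀ k₁ nodes₁ times₁, L.IsShortest i u t x k₁ nodes₁ times₁ →
      ∀ k₂ nodes₂ times₂, L.IsMinPathIoo t x t' w k₂ nodes₂ times₂ →
        L.IsShortest i u t' w (k₁ + k₂)
          (fun m => if h : m.1 ≤ k₁ then nodes₁ ⟨m.1, by omega⟩
            else nodes₂ ⟨m.1 - k₁, by have := m.isLt; omega⟩)
          (fun m => if h : m.1 < k₁ then times₁ ⟨m.1, h⟩
            else times₂ ⟨m.1 - k₁, by have := m.isLt; omega⟩)) := by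
  refine ⟨fun y hy hd k _ _ hP => ?_, fun x hd k₁ _ _ h₁ k₂ _ _ h₂ => ?_⟩
  · refine (hP.1.snoc hy).isShortest_of_le_dist ?_
    rw [← hd, hP.dist_eq]
  · refine (h₁.1.concat h₂.1.1 (fun m a h => ?_) (fun m a h => ?_) (fun a => ?_)
      (fun a => ?_)).isShortest_of_le_dist ?_
    · simp [h, Nat.le_of_lt_succ a.isLt]
    · rcases Fin.eq_zero_or_eq_succ a with rfl | ⟨j, rfl⟩
      · have h' : m.val = k₁ := h
        simp only [h', le_refl, dite_true]
        exact h₁.1.2.1.trans h₂.1.1.1.symm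
      · have hlt : ¬ k₁ + (j.succ).val ≤ k₁ := by simp
        simp only [h, hlt, dite_false, Nat.add_sub_cancel_left]
    · simp
    · simp
    rw [← hd, h₁.dist_eq]
    exact Nat.add_le_add_left (h₂.le_dist htt hG) k₁
end

section
/- Let L=(T,V,E) be a link stream, u,w ∈ V, and (t,v) ∈ T×V. If (s,a) and (s',a') are latency pairs from u to w such that some path of length ≥ 1 from (s,u) to (a,w) involves (t,v) and some path of length ≥ 1 from (s',u) to (a',w) involves (t,v), then (s,a) = (s',a'). In particular, at most one latency pair from u to w has a shortest fastest path involving (t,v). -/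
namespace LinkStream

variable {V : Type*} {L : LinkStream V} {u v w : V}

theorem IsPathOn.mono {x y x' y' : ℝ} {k : ℕ} {nodes : Fin (k + 1) → V} {times : Fin k → ℝ}
    (h : L.IsPathOn x u y w k nodes times) (hx : x' ≤ x) (hy : y ≤ y') :
    L.IsPathOn x' u y' w k nodes times := by
  obtain ⟨h0, hl, hxy, ht, hm, hE⟩ := h
  exact ⟨h0, hl, by linarith, fun m => ⟨hx.trans (ht m).1, (ht m).2.trans hy⟩, hm, hE⟩

theorem IsPathOn.le_startT {x y : ℝ} {k : ℕ} {nodes : Fin (k + 1) → V} {times : Fin k → ℝ}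
    (h : L.IsPathOn x u y w k nodes times) (hk : 1 ≤ k) : x ≤ startT times := by
  rw [startT, dif_pos (show 0 < k from hk)]
  exact (h.2.2.2.1 _).1

theorem IsPathOn.arrT_le {x y : ℝ} {k : ℕ} {nodes : Fin (k + 1) → V} {times : Fin k → ℝ}
    (h : L.IsPathOn x u y w k nodes times) (hk : 1 ≤ k) : arrT times ≤ y := by
  rw [arrT, dif_pos (show 0 < k from hk)]
  exact (h.2.2.2.1 _).2

/-- The first `i` steps of a path, when they are all made by time `t`. -/
theorem IsPathOn.take {x y t : ℝ} {k : ℕ} {nodes : Fin (k + 1) → V} {times : Fin k → ℝ}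
    (h : L.IsPathOn x u y w k nodes times) (i : ℕ) (hi : i ≤ k) (hxt : x ≤ t)
    (ht : ∀ m : Fin k, (m : ℕ) < i → times m ≤ t) :
    L.IsPathOn x u t (nodes ⟨i, by omega⟩) i (fun m => nodes ⟨m, by omega⟩)
      (fun m => times ⟨m, by omega⟩) :=
  ⟨h.1, rfl, hxt, fun m => ⟨(h.2.2.2.1 _).1, ht _ m.2⟩,
    fun _ _ hm => h.2.2.2.2.1 _ _ hm, fun m => h.2.2.2.2.2 ⟨m, by omega⟩⟩

/-- What remains of a path after `i` steps, when the remaining steps are all made from time `t`. -/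
theorem IsPathOn.drop {x y t : ℝ} {k : ℕ} {nodes : Fin (k + 1) → V} {times : Fin k → ℝ}
    (h : L.IsPathOn x u y w k nodes times) (i : ℕ) (hi : i ≤ k) (hty : t ≤ y)
    (ht : ∀ m : Fin k, i ≤ (m : ℕ) → t ≤ times m) :
    L.IsPathOn t (nodes ⟨i, by omega⟩) y w (k - i) (fun m => nodes ⟨i + m, by omega⟩)
      (fun m => times ⟨i + m, by omega⟩) := by
  refine ⟨rfl, ?_, hty, fun m => ⟨ht _ (Nat.le_add_right _ _), (h.2.2.2.1 _).2⟩,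
    fun m m' hm => h.2.2.2.2.1 _ _ ?_, fun m => h.2.2.2.2.2 ⟨i + m, by omega⟩⟩
  · rw [← h.2.1]
    exact congrArg nodes (Fin.ext (Nat.add_sub_cancel' hi))
  · exact Nat.add_le_add_left hm i

theorem IsPathOn.concat_s12 {x y z : ℝ} {k l : ℕ} {nodes : Fin (k + 1) → V} {times : Fin k → ℝ}
    {nodes' : Fin (l + 1) → V} {times' : Fin l → ℝ}
    (h : L.IsPathOn x u z v k nodes times) (h' : L.IsPathOn z v y w l nodes' times') :
    ∃ nodes'' times'', L.IsPathOn x u y w (k + l) nodes'' times'' := by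
  obtain ⟨h0, hl, hxz, ht, hm, hE⟩ := h
  obtain ⟨h0', hl', hzy, ht', hm', hE'⟩ := h'
  refine ⟨fun m => if hk : (m : ℕ) ≤ k then nodes ⟨m, by omega⟩ else nodes' ⟨m - k, by omega⟩,
    fun m => if hk : (m : ℕ) < k then times ⟨m, hk⟩ else times' ⟨m - k, by omega⟩,
    ?_, ?_, hxz.trans hzy, fun m => ?_, fun m m' hmm => ?_, fun m => ?_⟩
  · simpa using h0
  · rcases Nat.eq_zero_or_pos l with rfl | hpos
    · simpa [← hl', h0', Fin.last] using hl
    · have : ¬ k + l ≤ k := by omega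
      simpa [this, hpos.ne', Fin.last] using hl'
  · dsimp only
    split_ifs with hk
    · exact ⟨(ht _).1, (ht _).2.trans hzy⟩
    · exact ⟨hxz.trans (ht' _).1, (ht' _).2⟩
  · have hmm : (m : ℕ) ≤ m' := hmm
    dsimp only
    split_ifs with hk hk' hk'
    · exact hm _ _ hmm
    · exact (ht _).2.trans (ht' _).1
    · omega
    · exact hm' _ _ (Nat.sub_le_sub_right hmm k)
  · simp only [Fin.val_castSucc, Fin.val_succ]
    rcases lt_trichotomy (m : ℕ) k with hk | hk | hk
    · rw [dif_pos hk, dif_pos hk.le, dif_pos (Nat.succ_le_of_lt hk)]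
      exact hE ⟨m, hk⟩
    · rw [dif_neg hk.not_lt, dif_pos hk.le, dif_neg (by omega)]
      have hn : nodes ⟨m, by omega⟩ = nodes' 0 := by
        rw [h0', ← hl]
        congr 1
        exact Fin.ext hk
      rw [hn]
      convert hE' ⟨m - k, by omega⟩ using 5
      · simp [hk]
      · simp [hk]
    · rw [dif_neg (by omega), dif_neg (by omega), dif_neg (by omega)]
      convert hE' ⟨m - k, by omega⟩ using 5
      · rfl
      · exact Nat.sub_add_comm hk.le

/-- A path involving `(t,v)` stands on `v` at time `t`, after some number `i` of steps. -/
theorem IsPathOn.exists_index_of_involves {x y t : ℝ} {k : ℕ} {nodes : Fin (k + 1) → V}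
    {times : Fin k → ℝ} (h : L.IsPathOn x u y w k nodes times) (hv : Involves nodes times t v) :
    ∃ (i : ℕ) (hi : i ≤ k), nodes ⟨i, by omega⟩ = v ∧ x ≤ t ∧ t ≤ y ∧
      (∀ m : Fin k, (m : ℕ) < i → times m ≤ t) ∧ (∀ m : Fin k, i ≤ (m : ℕ) → t ≤ times m) ∧
      (i = 0 → t = startT times) ∧ (i = k → t = arrT times) := by
  obtain ⟨-, -, -, ht, hm, -⟩ := h
  rcases hv with ⟨i, hi, hik, rfl, h1, h2⟩ | ⟨hk, rfl, rfl⟩ | ⟨hk, rfl, rfl⟩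
  · refine ⟨i, by omega, rfl, (ht _).1.trans h1, h2.trans (ht _).2, fun m hmi => ?_,
      fun m hmi => ?_, by omega, by omega⟩
    · exact (hm _ _ (Fin.mk_le_mk.2 (by omega) : m ≤ ⟨i - 1, by omega⟩)).trans h1
    · exact h2.trans (hm _ _ hmi)
  · refine ⟨0, by omega, rfl, (ht _).1, (ht _).2, by omega, fun m _ => hm _ _ (Nat.zero_le _),
      fun _ => ?_, by omega⟩
    rw [startT, dif_pos (show 0 < k from hk)]
  · refine ⟨k, le_rfl, rfl, (ht _).1, (ht _).2,
      fun m _ => hm _ _ (Fin.mk_le_mk.2 (by omega) : m ≤ ⟨k - 1, by omega⟩), by omega, by omega,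
      fun _ => ?_⟩
    rw [arrT, dif_pos (show 0 < k from hk)]

/-- A latency pair contains no smaller interval in which `w` can be reached from `u`. -/
theorem IsLatencyPair.eq_of_isPathOn {s a x y : ℝ} (hL : L.IsLatencyPair u w s a) {k : ℕ}
    {nodes : Fin (k + 1) → V} {times : Fin k → ℝ} (h : L.IsPathOn x u y w k nodes times)
    (hk : 1 ≤ k) (hx : s ≤ x) (hy : y ≤ a) : x = s ∧ y = a := by
  obtain ⟨hs, ha⟩ := hL.2.2.2.2 _ _ _ hk (h.mono hx hy)
  have := h.le_startT hk
  have := h.arrT_le hk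
  constructor <;> linarith

/-- A latency pair from a node to itself is instantaneous: one may go back along the first link. -/
theorem IsLatencyPair.eq_of_loop {s a : ℝ} (hL : L.IsLatencyPair u u s a) : s = a := by
  obtain ⟨k, nodes, times, hk, h0, -, -, ht, -, hE⟩ := hL.2.2.2.1
  let i : Fin k := ⟨0, hk⟩
  have hi : (times i, s(u, nodes i.succ)) ∈ L.E := by
    rw [← h0]
    exact hE i
  have hp : L.IsPathOn (times i) u (times i) u 2 ![u, nodes i.succ, u] (fun _ => times i) := by
    refine ⟨rfl, rfl, le_rfl, fun _ => ⟨le_rfl, le_rfl⟩, fun _ _ _ => le_rfl, fun m => ?_⟩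
    fin_cases m
    · exact hi
    · rw [Sym2.eq_swap] at hi
      exact hi
  obtain ⟨hs, ha⟩ := hL.eq_of_isPathOn hp (by norm_num) (ht i).1 (ht i).2
  exact hs.symm.trans ha

theorem IsLatencyPair.eq_of_involves_of_le {s a s' a' t : ℝ} (hL : L.IsLatencyPair u w s a)
    (hL' : L.IsLatencyPair u w s' a') {k k' : ℕ} {nodes : Fin (k + 1) → V} {times : Fin k → ℝ}
    {nodes' : Fin (k' + 1) → V} {times' : Fin k' → ℝ}
    (hk : 1 ≤ k) (h : L.IsPathOn s u a w k nodes times) (hv : Involves nodes times t v)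
    (hk' : 1 ≤ k') (h' : L.IsPathOn s' u a' w k' nodes' times') (hv' : Involves nodes' times' t v)
    (hss : s ≤ s') : s = s' ∧ a = a' := by
  rcases le_total a' a with haa | haa
  · obtain ⟨h1, h2⟩ := hL.eq_of_isPathOn h' hk' hss haa
    exact ⟨h1.symm, h2.symm⟩
  obtain ⟨i, hi, hiv, -, hta, -, hge, -, hlast⟩ := h.exists_index_of_involves hv
  obtain ⟨j, hj, hjv, hst, -, hle, -, hzero, -⟩ := h'.exists_index_of_involves hv'
  have hpre := h'.take j hj hst hle
  have hsuf := h.drop i hi hta hge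
  rw [hjv] at hpre
  rw [hiv] at hsuf
  obtain ⟨nodes'', times'', hp⟩ := hpre.concat_s12 hsuf
  rcases Nat.eq_zero_or_pos (j + (k - i)) with hlen | hlen
  · obtain rfl : j = 0 := by omega
    obtain rfl : i = k := by omega
    have huw : u = w := by
      rw [← h'.1, ← h.2.1]
      exact hjv.trans hiv.symm
    subst huw
    have hsa := hL.eq_of_loop
    have hts := (hzero rfl).trans (hL'.2.2.2.2 _ _ _ hk' h').1
    obtain ⟨h1, h2⟩ := hL'.eq_of_isPathOn h hk (by linarith) haa
    exact ⟨h1, h2⟩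
  · exact ⟨(hL.eq_of_isPathOn hp hlen hss le_rfl).1.symm,
      (hL'.eq_of_isPathOn hp hlen le_rfl haa).2⟩

end LinkStream

/-- if two latency pairs from `u` to `w` both admit a path of length ≥ 1
involving `(t,v)`, then they are equal; in particular at most one latency pair from `u`
to `w` has a shortest fastest path involving `(t,v)`. -/
theorem unique_latency_pair_involving {V : Type*} (L : LinkStream V) (u w v : V) (t : ℝ) :
    (∀ s a s' a', L.IsLatencyPair u w s a → L.IsLatencyPair u w s' a' →
      (∃ k nodes times, 1 ≤ k ∧ L.IsPathOn s u a w k nodes times ∧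
        Involves nodes times t v) →
      (∃ k nodes times, 1 ≤ k ∧ L.IsPathOn s' u a' w k nodes times ∧
        Involves nodes times t v) →
      (s, a) = (s', a')) ∧
    (∀ s a s' a', L.IsLatencyPair u w s a → L.IsLatencyPair u w s' a' →
      (∃ k nodes times, L.IsSFP s u a w k nodes times ∧ Involves nodes times t v) →
      (∃ k nodes times, L.IsSFP s' u a' w k nodes times ∧ Involves nodes times t v) →
      (s, a) = (s', a')) := by
  have main : ∀ s a s' a', L.IsLatencyPair u w s a → L.IsLatencyPair u w s' a' →
      (∃ k nodes times, 1 ≤ k ∧ L.IsPathOn s u a w k nodes times ∧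
        Involves nodes times t v) →
      (∃ k nodes times, 1 ≤ k ∧ L.IsPathOn s' u a' w k nodes times ∧
        Involves nodes times t v) →
      (s, a) = (s', a') := by
    rintro s a s' a' hL hL' ⟨k, nodes, times, hk, h, hv⟩ ⟨k', nodes', times', hk', h', hv'⟩
    rw [Prod.mk.injEq]
    rcases le_total s s' with hss | hss
    · exact hL.eq_of_involves_of_le hL' hk h hv hk' h' hv' hss
    · obtain ⟨h1, h2⟩ := hL'.eq_of_involves_of_le hL hk' h' hv' hk h hv hss
      exact ⟨h1.symm, h2.symm⟩
  refine ⟨main, ?_⟩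
  rintro s a s' a' hL hL' ⟨k, nodes, times, h, hv⟩ ⟨k', nodes', times', h', hv'⟩
  exact main s a s' a' hL hL' ⟨k, nodes, times, h.1.1, h.1.2.1, hv⟩
    ⟨k', nodes', times', h'.1.1, h'.1.2.1, hv'⟩
end
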